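/- arXiv:1909.11709 — 5 statements merged into one kernel-verified Lean document; each statement's English description precedes it below -/
import Mathlib

section
/- Let m, n, p ∈ ℕ with q := m−p+2 > 0, let γ, A, B ∈ ℂ, let α ∈ ℂ satisfy α(α−A+1) = −B, let l ∈ ℕ, and set a = −(α+l)/q, b = (1+α−A−l)/q, c = (n+γ+1)/(n+2). Let t₀, x₀ ∈ ℂ with t₀ ≠ 0 and x₀ ≠ 0, and set z₀ = (q/(n+2))² t₀^{n+2}/x₀^q. Suppose w : ℂ → ℂ is analytic on a neighborhood of z₀ and satisfies the Gauss hypergeometric equation z(1−z)w''(z) + [c − (1+a+b)z]w'(z) − a·b·w(z) = 0 on that neighborhood. Then the function u(t,x) = x^l · w((q/(n+2))² t^{n+2}/x^q) satisfies x₀^m (∂_t² u + (γ/t₀) ∂_t u) − t₀^n x₀^{p−2} (x₀² ∂_x² u + A x₀ ∂_x u + B u) = 0 at (t₀, x₀), where ∂_t and ∂_x denote the complex partial derivatives in the first and second variable respectively. -/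
/-- Partial derivative in the first (time) variable. -/
noncomputable def dT (u : ℂ → ℂ → ℂ) : ℂ → ℂ → ℂ := fun t x => deriv (fun s => u s x) t

/-- Partial derivative in the second (space) variable. -/
noncomputable def dX (u : ℂ → ℂ → ℂ) : ℂ → ℂ → ℂ := fun t x => deriv (fun y => u t y) x

/-- The derivative of a power at a nonzero point, without a shifted exponent. -/
lemma hasDerivAt_pow_div (l : ℕ) {x : ℂ} (hx : x ≠ 0) :
    HasDerivAt (fun y : ℂ => y ^ l) (l * x ^ l / x) x := by
  refine (hasDerivAt_pow l x).congr_deriv ?_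
  rcases l with _ | l
  · simp
  · field_simp
    simp [pow_succ]

/-- In the time variable, `t ∂ₜ` acts on `x ^ l * f (k * t ^ N / x ^ q)` as `N * (z d/dz)` on `f`. -/
lemma hasDerivAt_profile_time (l N q : ℕ) (k x : ℂ) {t : ℂ} (ht : t ≠ 0) {f : ℂ → ℂ}
    {f' : ℂ} (hf : HasDerivAt f f' (k * t ^ N / x ^ q)) :
    HasDerivAt (fun s => x ^ l * f (k * s ^ N / x ^ q))
      (N / t * (x ^ l * (k * t ^ N / x ^ q * f'))) t := by
  have hz : HasDerivAt (fun s : ℂ => k * s ^ N / x ^ q) (k * (N * t ^ N / t) / x ^ q) t :=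
    ((hasDerivAt_pow_div N ht).const_mul k).div_const _
  refine ((hf.comp t hz).const_mul (x ^ l)).congr_deriv ?_
  ring

/-- In the space variable, `x ∂ₓ` acts on `x ^ l * f (k * t ^ N / x ^ q)` as `l - q * (z d/dz)`
on `f`. -/
lemma hasDerivAt_profile_space (l N q : ℕ) (k t : ℂ) {x : ℂ} (hx : x ≠ 0) {f : ℂ → ℂ}
    {f' : ℂ} (hf : HasDerivAt f f' (k * t ^ N / x ^ q)) :
    HasDerivAt (fun y => y ^ l * f (k * t ^ N / y ^ q))
      (1 / x * (x ^ l * (l * f (k * t ^ N / x ^ q) - q * (k * t ^ N / x ^ q * f')))) x := by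
  have hz : HasDerivAt (fun y : ℂ => k * t ^ N / y ^ q)
      (-(q * (k * t ^ N / x ^ q)) / x) x := by
    refine ((hasDerivAt_const x (k * t ^ N)).div (hasDerivAt_pow_div q hx)
      (pow_ne_zero q hx)).congr_deriv ?_
    field_simp
    ring
  refine ((hasDerivAt_pow_div l hx).mul (hf.comp x hz)).congr_deriv ?_
  simp only [Function.comp_apply]
  ring

/-- Second time derivative of `x ^ l * w (k * t ^ N / x ^ q)`. -/
lemma deriv_deriv_profile_time (l N q : ℕ) (k x : ℂ) {t : ℂ} (ht : t ≠ 0) {w : ℂ → ℂ} {z : ℂ}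
    (hz : z = k * t ^ N / x ^ q) (hw : AnalyticAt ℂ w z) :
    deriv (deriv fun s => x ^ l * w (k * s ^ N / x ^ q)) t =
      x ^ l / t ^ 2 * (N ^ 2 * (z * (deriv w z + z * deriv (deriv w) z))
        - N * (z * deriv w z)) := by
  have hc : ContinuousAt (fun s : ℂ => k * s ^ N / x ^ q) t := by fun_prop
  have hev : (deriv fun s => x ^ l * w (k * s ^ N / x ^ q)) =ᶠ[nhds t] fun s =>
      N / s * (x ^ l * (fun v => v * deriv w v) (k * s ^ N / x ^ q)) := by
    filter_upwards [hc.eventually (hz ▸ hw.eventually_analyticAt), eventually_ne_nhds ht]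
      with s hs hs0
    exact (hasDerivAt_profile_time l N q k x hs0 hs.differentiableAt.hasDerivAt).deriv
  have hθ : HasDerivAt (fun v => v * deriv w v) (1 * deriv w z + z * deriv (deriv w) z) z :=
    (hasDerivAt_id z).mul hw.deriv.differentiableAt.hasDerivAt
  have hdiv : HasDerivAt (fun s : ℂ => (N : ℂ) / s) (-N / t ^ 2) t := by
    refine ((hasDerivAt_const t (N : ℂ)).div (hasDerivAt_id t) ht).congr_deriv ?_
    simp
  rw [hev.deriv_eq]
  subst hz
  refine ((hdiv.mul (hasDerivAt_profile_time l N q k x ht hθ)).deriv).trans ?_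
  ring

/-- Second space derivative of `x ^ l * w (k * t ^ N / x ^ q)`. -/
lemma deriv_deriv_profile_space (l N q : ℕ) (k t : ℂ) {x : ℂ} (hx : x ≠ 0) {w : ℂ → ℂ} {z : ℂ}
    (hz : z = k * t ^ N / x ^ q) (hw : AnalyticAt ℂ w z) :
    deriv (deriv fun y => y ^ l * w (k * t ^ N / y ^ q)) x =
      x ^ l / x ^ 2 * ((l - 1) * (l * w z - q * (z * deriv w z))
        - q * (z * (l * deriv w z - q * (deriv w z + z * deriv (deriv w) z)))) := by
  have hc : ContinuousAt (fun y : ℂ => k * t ^ N / y ^ q) x :=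
    continuousAt_const.div (by fun_prop) (pow_ne_zero q hx)
  have hev : (deriv fun y => y ^ l * w (k * t ^ N / y ^ q)) =ᶠ[nhds x] fun y =>
      1 / y * (y ^ l * (fun v => l * w v - q * (v * deriv w v)) (k * t ^ N / y ^ q)) := by
    filter_upwards [hc.eventually (hz ▸ hw.eventually_analyticAt), eventually_ne_nhds hx]
      with y hy hy0
    exact (hasDerivAt_profile_space l N q k t hy0 hy.differentiableAt.hasDerivAt).deriv
  have hθ : HasDerivAt (fun v => l * w v - q * (v * deriv w v))
      (l * deriv w z - q * (1 * deriv w z + z * deriv (deriv w) z)) z :=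
    (hw.differentiableAt.hasDerivAt.const_mul _).sub
      (((hasDerivAt_id z).mul hw.deriv.differentiableAt.hasDerivAt).const_mul _)
  have hdiv : HasDerivAt (fun y : ℂ => 1 / y) (-1 / x ^ 2) x := by
    refine ((hasDerivAt_const x (1 : ℂ)).div (hasDerivAt_id x) hx).congr_deriv ?_
    simp
  rw [hev.deriv_eq]
  subst hz
  refine ((hdiv.mul (hasDerivAt_profile_space l N q k t hx hθ)).deriv).trans ?_
  ring

/-- If `w` is analytic near `z₀` and satisfies the Gauss hypergeometric
equation with parameters `a = −(α+l)/q`, `b = (1+α−A−l)/q`, `c = (n+γ+1)/(n+2)` (where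
`α(α−A+1) = −B`), then `u(t,x) = x^l · w((q/(n+2))² t^(n+2)/x^q)` satisfies `L_γ u = 0`
at `(t₀, x₀)`. -/
theorem reduction_to_hypergeometric (m n p : ℕ) (q : ℕ)
    (hq : (q : ℤ) = (m : ℤ) - (p : ℤ) + 2) (hq0 : 0 < q)
    (γ A B α : ℂ) (hα : α * (α - A + 1) = -B) (l : ℕ)
    (a b c : ℂ)
    (ha : a = -(α + (l : ℂ)) / (q : ℂ))
    (hb : b = (1 + α - A - (l : ℂ)) / (q : ℂ))
    (hc : c = ((n : ℂ) + γ + 1) / ((n : ℂ) + 2))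
    (t₀ x₀ : ℂ) (ht : t₀ ≠ 0) (hx : x₀ ≠ 0)
    (z₀ : ℂ) (hz₀ : z₀ = ((q : ℂ) / ((n : ℂ) + 2)) ^ 2 * t₀ ^ (n + 2) / x₀ ^ q)
    (w : ℂ → ℂ) (S : Set ℂ) (hS : S ∈ nhds z₀) (hw : AnalyticOnNhd ℂ w S)
    (hode : ∀ z ∈ S,
      z * (1 - z) * deriv (deriv w) z + (c - (1 + a + b) * z) * deriv w z - a * b * w z = 0)
    (u : ℂ → ℂ → ℂ)
    (hu : ∀ t x : ℂ, u t x = x ^ l * w (((q : ℂ) / ((n : ℂ) + 2)) ^ 2 * t ^ (n + 2) / x ^ q)) :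
    x₀ ^ m * (dT (dT u) t₀ x₀ + γ / t₀ * dT u t₀ x₀)
      - t₀ ^ n * x₀ ^ ((p : ℤ) - 2) *
        (x₀ ^ 2 * dX (dX u) t₀ x₀ + A * x₀ * dX u t₀ x₀ + B * u t₀ x₀) = 0 := by
  have hwz : AnalyticAt ℂ w z₀ := hw z₀ (mem_of_mem_nhds hS)
  have hode₀ := hode z₀ (mem_of_mem_nhds hS)
  set k : ℂ := ((q : ℂ) / ((n : ℂ) + 2)) ^ 2 with hk
  obtain rfl : u = fun t x => x ^ l * w (k * t ^ (n + 2) / x ^ q) := funext₂ hu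
  have hN : (n : ℂ) + 2 ≠ 0 := by exact_mod_cast (by omega : n + 2 ≠ 0)
  have hq' : (q : ℂ) ≠ 0 := by exact_mod_cast hq0.ne'
  have hwd : HasDerivAt w (deriv w z₀) (k * t₀ ^ (n + 2) / x₀ ^ q) :=
    hz₀ ▸ hwz.differentiableAt.hasDerivAt
  have hT := (hasDerivAt_profile_time l (n + 2) q k x₀ ht hwd).deriv
  have hX := (hasDerivAt_profile_space l (n + 2) q k t₀ hx hwd).deriv
  have hTT := deriv_deriv_profile_time l (n + 2) q k x₀ ht hz₀ hwz
  have hXX := deriv_deriv_profile_space l (n + 2) q k t₀ hx hz₀ hwz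
  rw [← hz₀] at hT hX
  have hpow : t₀ ^ n * x₀ ^ ((p : ℤ) - 2) * q ^ 2 * t₀ ^ 2 = x₀ ^ m * ((n + 2) ^ 2 * z₀) := by
    have hm : x₀ ^ m = x₀ ^ ((p : ℤ) - 2) * x₀ ^ q := by
      rw [← zpow_natCast, ← zpow_natCast, ← zpow_add₀ hx]
      congr 1
      omega
    rw [hz₀, hm, hk]
    field_simp
    ring
  have htime : t₀ ^ 2 * (dT (dT fun t x => x ^ l * w (k * t ^ (n + 2) / x ^ q)) t₀ x₀ + γ / t₀ *
      dT (fun t x => x ^ l * w (k * t ^ (n + 2) / x ^ q)) t₀ x₀) =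
      x₀ ^ l * ((n + 2) ^ 2 * (z₀ * (c * deriv w z₀ + z₀ * deriv (deriv w) z₀))) := by
    simp only [dT]
    rw [hT, show (fun s => deriv (fun s => x₀ ^ l * w (k * s ^ (n + 2) / x₀ ^ q)) s) =
      deriv fun s => x₀ ^ l * w (k * s ^ (n + 2) / x₀ ^ q) from rfl, hTT, hc]
    push_cast
    field_simp
    ring
  have hspace : x₀ ^ 2 * dX (dX fun t x => x ^ l * w (k * t ^ (n + 2) / x ^ q)) t₀ x₀ +
      A * x₀ * dX (fun t x => x ^ l * w (k * t ^ (n + 2) / x ^ q)) t₀ x₀ +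
      B * (x₀ ^ l * w (k * t₀ ^ (n + 2) / x₀ ^ q)) =
      x₀ ^ l * (q ^ 2 * (z₀ * (z₀ * deriv (deriv w) z₀) + (1 + a + b) * (z₀ * deriv w z₀) +
        a * b * w z₀)) := by
    simp only [dX]
    rw [hX, show (fun y => deriv (fun y => y ^ l * w (k * t₀ ^ (n + 2) / y ^ q)) y) =
      deriv fun y => y ^ l * w (k * t₀ ^ (n + 2) / y ^ q) from rfl, hXX, ← hz₀, ha, hb,
      show B = -(α * (α - A + 1)) by rw [hα, neg_neg]]
    field_simp
    ring
  have ht2 : t₀ ^ 2 ≠ 0 := pow_ne_zero 2 ht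
  refine (mul_eq_zero.mp ?_).resolve_left ht2
  beta_reduce
  rw [hspace]
  linear_combination x₀ ^ m * htime - x₀ ^ l * (z₀ * (z₀ * deriv (deriv w) z₀) +
    (1 + a + b) * (z₀ * deriv w z₀) + a * b * w z₀) * hpow +
    x₀ ^ m * x₀ ^ l * (n + 2) ^ 2 * z₀ * hode₀
end

section
/- Let m, n, p ∈ ℕ with q := m−p+2 > 0, let γ, A, B ∈ ℂ with −γ ∉ {1,2,3,…}, let α ∈ ℂ satisfy α(α−A+1) = −B, let l ∈ ℕ, and set a = −(α+l)/q, b = (1+α−A−l)/q, c = (n+γ+1)/(n+2), with −c ∉ ℕ∪{0}. Let x₀ ∈ ℂ, x₀ ≠ 0. Suppose u : ℂ × ℂ → ℂ is analytic on a neighborhood Ω of (0,x₀), satisfies x^m (∂_t² u + (γ/t) ∂_t u) − t^n x^{p−2} (x² ∂_x² u + A x ∂_x u + B u) = 0 at every point (t,x) ∈ Ω with t ≠ 0, and satisfies u(0,x) = x^l and ∂_t u(0,x) = 0 for all x with (0,x) ∈ Ω. Then u coincides with U_l(t,x) = x^l · F(a,b,c, (q/(n+2))² t^{n+2}/x^q)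 on a neighborhood of (0,x₀). -/
/-- The Pochhammer symbol `(λ)_i = λ(λ+1)⋯(λ+i−1)`. -/
noncomputable def poch (x : ℂ) (i : ℕ) : ℂ := (ascPochhammer ℂ i).eval x

/-- The Gauss hypergeometric series `F(a,b,c,z) = ∑ᵢ ((a)ᵢ (b)ᵢ / ((c)ᵢ · i!)) zⁱ`. -/
noncomputable def hypF (a b c z : ℂ) : ℂ :=
  ∑' i : ℕ, poch a i * poch b i / (poch c i * (Nat.factorial i : ℂ)) * z ^ i

open Filter Topology

/-- The partial derivative in the first variable. -/
noncomputable def pderivFst (f : ℂ × ℂ → ℂ) (P : ℂ × ℂ) : ℂ := deriv (fun s => f (s, P.2)) P.1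

/-- The partial derivative in the second variable. -/
noncomputable def pderivSnd (f : ℂ × ℂ → ℂ) (P : ℂ × ℂ) : ℂ := deriv (fun y => f (P.1, y)) P.2

theorem DifferentiableAt.pderivFst_eq {f : ℂ × ℂ → ℂ} {P : ℂ × ℂ} (hf : DifferentiableAt ℂ f P) :
    pderivFst f P = fderiv ℂ f P (1, 0) := by
  have h : HasFDerivAt f (fderiv ℂ f P) (P.1, P.2) := hf.hasFDerivAt
  exact (h.comp_hasDerivAt P.1 ((hasDerivAt_id P.1).prodMk (hasDerivAt_const P.1 P.2))).deriv

theorem DifferentiableAt.pderivSnd_eq {f : ℂ × ℂ → ℂ} {P : ℂ × ℂ} (hf : DifferentiableAt ℂ f P) :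
    pderivSnd f P = fderiv ℂ f P (0, 1) := by
  have h : HasFDerivAt f (fderiv ℂ f P) (P.1, P.2) := hf.hasFDerivAt
  exact (h.comp_hasDerivAt P.2 ((hasDerivAt_const P.2 P.1).prodMk (hasDerivAt_id P.2))).deriv

theorem AnalyticAt.pderivFst_eventuallyEq {f : ℂ × ℂ → ℂ} {P : ℂ × ℂ} (hf : AnalyticAt ℂ f P) :
    pderivFst f =ᶠ[𝓝 P] fun Q => fderiv ℂ f Q (1, 0) :=
  hf.eventually_analyticAt.mono fun _ h => h.differentiableAt.pderivFst_eq

theorem AnalyticAt.pderivSnd_eventuallyEq {f : ℂ × ℂ → ℂ} {P : ℂ × ℂ} (hf : AnalyticAt ℂ f P) :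
    pderivSnd f =ᶠ[𝓝 P] fun Q => fderiv ℂ f Q (0, 1) :=
  hf.eventually_analyticAt.mono fun _ h => h.differentiableAt.pderivSnd_eq

theorem AnalyticAt.pderivFst {f : ℂ × ℂ → ℂ} {P : ℂ × ℂ} (hf : AnalyticAt ℂ f P) :
    AnalyticAt ℂ (pderivFst f) P :=
  (((ContinuousLinearMap.apply ℂ ℂ ((1, 0) : ℂ × ℂ)).analyticAt _).comp hf.fderiv).congr
    hf.pderivFst_eventuallyEq.symm

theorem AnalyticAt.pderivSnd {f : ℂ × ℂ → ℂ} {P : ℂ × ℂ} (hf : AnalyticAt ℂ f P) :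
    AnalyticAt ℂ (pderivSnd f) P :=
  (((ContinuousLinearMap.apply ℂ ℂ ((0, 1) : ℂ × ℂ)).analyticAt _).comp hf.fderiv).congr
    hf.pderivSnd_eventuallyEq.symm

theorem AnalyticAt.iterate_pderivFst {f : ℂ × ℂ → ℂ} {P : ℂ × ℂ} (hf : AnalyticAt ℂ f P) (k : ℕ) :
    AnalyticAt ℂ (_root_.pderivFst^[k] f) P := by
  induction k with
  | zero => exact hf
  | succ k ih => rw [Function.iterate_succ_apply']; exact ih.pderivFst

theorem Filter.EventuallyEq.pderivFst_eq {f g : ℂ × ℂ → ℂ} {P : ℂ × ℂ} (h : f =ᶠ[𝓝 P] g) :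
    pderivFst f P = pderivFst g P := by
  have hc : ContinuousAt (fun s : ℂ => (s, P.2)) P.1 := by fun_prop
  exact EventuallyEq.deriv_eq (hc.eventually (p := fun Q => f Q = g Q) h)

theorem AnalyticAt.pderivFst_pderivSnd {f : ℂ × ℂ → ℂ} {P : ℂ × ℂ} (hf : AnalyticAt ℂ f P) :
    _root_.pderivFst (_root_.pderivSnd f) P = _root_.pderivSnd (_root_.pderivFst f) P := by
  have hd : DifferentiableAt ℂ (fderiv ℂ f) P := hf.fderiv.differentiableAt
  rw [hf.pderivSnd.differentiableAt.pderivFst_eq, hf.pderivFst.differentiableAt.pderivSnd_eq,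
    hf.pderivSnd_eventuallyEq.fderiv_eq, hf.pderivFst_eventuallyEq.fderiv_eq,
    fderiv_clm_apply hd (by fun_prop), fderiv_clm_apply hd (by fun_prop)]
  simpa using hf.contDiffAt.isSymmSndFDerivAt_of_omega (1, 0) (0, 1)

theorem AnalyticAt.iterate_pderivFst_pderivSnd {f : ℂ × ℂ → ℂ} {P : ℂ × ℂ}
    (hf : AnalyticAt ℂ f P) (k : ℕ) :
    _root_.pderivFst^[k] (_root_.pderivSnd f) P = _root_.pderivSnd (_root_.pderivFst^[k] f) P := by
  induction k generalizing P with
  | zero => rfl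
  | succ k ih =>
    have h : _root_.pderivFst^[k] (_root_.pderivSnd f) =ᶠ[𝓝 P]
        _root_.pderivSnd (_root_.pderivFst^[k] f) :=
      hf.eventually_analyticAt.mono fun _ hQ => ih hQ
    rw [Function.iterate_succ_apply', Function.iterate_succ_apply', h.pderivFst_eq,
      (hf.iterate_pderivFst k).pderivFst_pderivSnd]

theorem iteratedDeriv_fst_eq (f : ℂ × ℂ → ℂ) (k : ℕ) (t x : ℂ) :
    iteratedDeriv k (fun s => f (s, x)) t = pderivFst^[k] f (t, x) := by
  induction k generalizing t with
  | zero => rfl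
  | succ k ih =>
    rw [iteratedDeriv_succ, Function.iterate_succ_apply', pderivFst]
    exact congrArg (fun g => deriv g t) (funext ih)

/-- The Taylor coefficients at the origin. -/
noncomputable def taylorCoeffZero (k : ℕ) (f : ℂ → ℂ) : ℂ := iteratedDeriv k f 0 / (k.factorial : ℂ)

theorem taylorCoeffZero_deriv (k : ℕ) (f : ℂ → ℂ) :
    taylorCoeffZero k (deriv f) = (k + 1) * taylorCoeffZero (k + 1) f := by
  have h : (k.factorial : ℂ) ≠ 0 := mod_cast k.factorial_ne_zero
  have h' : (k : ℂ) + 1 ≠ 0 := mod_cast k.succ_ne_zero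
  rw [taylorCoeffZero, taylorCoeffZero, ← iteratedDeriv_succ', Nat.factorial_succ]
  push_cast
  field_simp

theorem taylorCoeffZero_add (k : ℕ) {f g : ℂ → ℂ} (hf : AnalyticAt ℂ f 0) (hg : AnalyticAt ℂ g 0) :
    taylorCoeffZero k (fun t => f t + g t) = taylorCoeffZero k f + taylorCoeffZero k g := by
  rw [taylorCoeffZero, iteratedDeriv_fun_add hf.contDiffAt hg.contDiffAt, add_div]; rfl

theorem taylorCoeffZero_const_mul (k : ℕ) (c : ℂ) (f : ℂ → ℂ) :
    taylorCoeffZero k (fun t => c * f t) = c * taylorCoeffZero k f := by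
  rw [taylorCoeffZero, iteratedDeriv_const_mul_field, mul_div_assoc]; rfl

theorem taylorCoeffZero_pow_mul (k j : ℕ) {f : ℂ → ℂ} (hf : AnalyticAt ℂ f 0) :
    taylorCoeffZero k (fun t => t ^ j * f t) =
      if j ≤ k then taylorCoeffZero (k - j) f else 0 := by
  have hp : AnalyticAt ℂ (fun t : ℂ => t ^ j) 0 := by fun_prop
  rw [taylorCoeffZero, iteratedDeriv_fun_mul hp.contDiffAt hf.contDiffAt]
  simp only [iteratedDeriv_fun_pow_zero]
  split_ifs with h
  · rw [Finset.sum_eq_single j]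
    · have h1 : (k.factorial : ℂ) ≠ 0 := mod_cast k.factorial_ne_zero
      have h2 : ((k - j).factorial : ℂ) ≠ 0 := mod_cast (k - j).factorial_ne_zero
      rw [taylorCoeffZero, if_pos rfl, ← Nat.choose_mul_factorial_mul_factorial h]
      rw [← Nat.choose_mul_factorial_mul_factorial h] at h1
      push_cast at h1 ⊢
      rw [div_eq_div_iff h1 h2]
      ring
    · intro i _ hi
      simp [hi]
    · intro hj
      simp at hj
      omega
  · rw [Finset.sum_eq_zero, zero_div]
    intro i hi
    rw [Finset.mem_range] at hi
    rw [if_neg (by omega)]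
    simp

theorem taylorCoeffZero_recurrence {φ ψ : ℂ → ℂ} (hφ : AnalyticAt ℂ φ 0) (hψ : AnalyticAt ℂ ψ 0)
    (γ : ℂ) (j : ℕ)
    (h : ∀ᶠ t in 𝓝 (0 : ℂ), t * deriv (deriv φ) t + γ * deriv φ t = t ^ j * ψ t) (k : ℕ) :
    (k + 1) * (k + γ) * taylorCoeffZero (k + 1) φ =
      if j ≤ k then taylorCoeffZero (k - j) ψ else 0 := by
  have h2 : AnalyticAt ℂ (fun t : ℂ => t ^ 1 * deriv (deriv φ) t) 0 :=
    (analyticAt_id.pow 1).mul hφ.deriv.deriv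
  have h1 : AnalyticAt ℂ (fun t : ℂ => γ * deriv φ t) 0 := analyticAt_const.mul hφ.deriv
  have key : taylorCoeffZero k (fun t => t ^ 1 * deriv (deriv φ) t + γ * deriv φ t) =
      taylorCoeffZero k (fun t => t ^ j * ψ t) := by
    simp only [pow_one]
    rw [taylorCoeffZero, EventuallyEq.iteratedDeriv_eq k h]; rfl
  rw [← taylorCoeffZero_pow_mul k j hψ, ← key, taylorCoeffZero_add k h2 h1,
    taylorCoeffZero_pow_mul k 1 hφ.deriv.deriv, taylorCoeffZero_const_mul]
  rcases k with _ | k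
  · simp [taylorCoeffZero_deriv]
  · simp only [taylorCoeffZero_deriv, Nat.add_sub_cancel, Nat.le_add_left, if_true]
    push_cast
    ring

theorem AnalyticAt.taylorCoeffZero_pderivSnd {f : ℂ × ℂ → ℂ} {x : ℂ} (hf : AnalyticAt ℂ f (0, x))
    (k : ℕ) : taylorCoeffZero k (fun t => _root_.pderivSnd f (t, x)) =
      deriv (fun y => taylorCoeffZero k (fun t => f (t, y))) x := by
  simp only [taylorCoeffZero, iteratedDeriv_fst_eq, hf.iterate_pderivFst_pderivSnd, deriv_div_const]
  rfl

theorem taylorCoeffZero_euler {u : ℂ × ℂ → ℂ} {Ω : Set (ℂ × ℂ)} (hΩ : IsOpen Ω)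
    (hu : AnalyticOnNhd ℂ u Ω) (A B : ℂ) {x : ℂ} (hx : (0, x) ∈ Ω) (k : ℕ) :
    taylorCoeffZero k (fun t => x ^ 2 * pderivSnd (pderivSnd u) (t, x)
        + A * x * pderivSnd u (t, x) + B * u (t, x)) =
      x ^ 2 * deriv (deriv fun y => taylorCoeffZero k fun t => u (t, y)) x
        + A * x * deriv (fun y => taylorCoeffZero k fun t => u (t, y)) x
        + B * taylorCoeffZero k (fun t => u (t, x)) := by
  have hux := hu _ hx
  have hc : AnalyticAt ℂ (fun t : ℂ => (t, x)) 0 := analyticAt_id.prod analyticAt_const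
  have h0 : AnalyticAt ℂ (fun t : ℂ => u (t, x)) 0 := AnalyticAt.comp hux hc
  have h1 : AnalyticAt ℂ (fun t : ℂ => pderivSnd u (t, x)) 0 :=
    AnalyticAt.comp (f := fun t : ℂ => (t, x)) (x := 0) hux.pderivSnd hc
  have h2 : AnalyticAt ℂ (fun t : ℂ => pderivSnd (pderivSnd u) (t, x)) 0 :=
    AnalyticAt.comp (f := fun t : ℂ => (t, x)) (x := 0) hux.pderivSnd.pderivSnd hc
  have hev : (fun y => taylorCoeffZero k fun t => pderivSnd u (t, y)) =ᶠ[𝓝 x]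
      deriv fun y => taylorCoeffZero k fun t => u (t, y) := by
    have hc' : ContinuousAt (fun y : ℂ => ((0 : ℂ), y)) x := by fun_prop
    filter_upwards [hc'.eventually (hΩ.mem_nhds hx)] with y hy
    exact (hu _ hy).taylorCoeffZero_pderivSnd k
  have h0' : AnalyticAt ℂ (fun t : ℂ => B * u (t, x)) 0 := analyticAt_const.mul h0
  have h1' : AnalyticAt ℂ (fun t : ℂ => A * x * pderivSnd u (t, x)) 0 := analyticAt_const.mul h1
  have h2' : AnalyticAt ℂ (fun t : ℂ => x ^ 2 * pderivSnd (pderivSnd u) (t, x)) 0 :=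
    analyticAt_const.mul h2
  have h21 : AnalyticAt ℂ (fun t : ℂ => x ^ 2 * pderivSnd (pderivSnd u) (t, x)
      + A * x * pderivSnd u (t, x)) 0 := h2'.add h1'
  rw [taylorCoeffZero_add k h21 h0', taylorCoeffZero_add k h2' h1',
    taylorCoeffZero_const_mul, taylorCoeffZero_const_mul,
    taylorCoeffZero_const_mul, hux.taylorCoeffZero_pderivSnd,
    hux.pderivSnd.taylorCoeffZero_pderivSnd, hev.deriv_eq]

theorem euler_operator_const_mul_zpow {f : ℂ → ℂ} {x : ℂ} (hx : x ≠ 0) (A B K : ℂ) (e : ℤ)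
    (hf : ∀ᶠ y in 𝓝 x, f y = K * y ^ e) :
    x ^ 2 * deriv (deriv f) x + A * x * deriv f x + B * f x =
      K * x ^ e * (e * (e - 1) + A * e + B) := by
  have h1 : ∀ᶠ y in 𝓝 x, deriv f y = K * (e * y ^ (e - 1)) := by
    filter_upwards [hf.eventually_nhds] with y hy
    rw [EventuallyEq.deriv_eq hy, deriv_const_mul_field, deriv_zpow]
  have h2 : deriv (deriv f) x = K * (e * ((e - 1 : ℤ) * x ^ (e - 1 - 1))) := by
    rw [EventuallyEq.deriv_eq h1, deriv_const_mul_field, deriv_const_mul_field, deriv_zpow]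
  rw [h2, h1.self_of_nhds, hf.self_of_nhds, zpow_sub_one₀ hx, zpow_sub_one₀ hx]
  push_cast
  field_simp

/-- The coefficients of the hypergeometric series. -/
noncomputable def hypCoeff (a b c : ℂ) (i : ℕ) : ℂ :=
  poch a i * poch b i / (poch c i * (Nat.factorial i : ℂ))

theorem poch_succ (x : ℂ) (i : ℕ) : poch x (i + 1) = poch x i * (x + i) :=
  ascPochhammer_succ_eval i x

theorem poch_ne_zero {c : ℂ} (hc : ∀ k : ℕ, -c ≠ (k : ℂ)) (i : ℕ) : poch c i ≠ 0 := by
  induction i with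
  | zero => simp [poch]
  | succ i ih =>
    rw [poch_succ]
    exact mul_ne_zero ih fun h => hc i (neg_eq_of_add_eq_zero_right h)

theorem hypCoeff_succ {c : ℂ} (hc : ∀ k : ℕ, -c ≠ (k : ℂ)) (a b : ℂ) (i : ℕ) :
    (i + 1) * (c + i) * hypCoeff a b c (i + 1) = (a + i) * (b + i) * hypCoeff a b c i := by
  have h1 : poch c i ≠ 0 := poch_ne_zero hc i
  have h2 : c + i ≠ 0 := fun h => hc i (neg_eq_of_add_eq_zero_right h)
  have h3 : (i.factorial : ℂ) ≠ 0 := mod_cast i.factorial_ne_zero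
  have h4 : (i : ℂ) + 1 ≠ 0 := mod_cast i.succ_ne_zero
  rw [hypCoeff, hypCoeff, poch_succ, poch_succ, poch_succ, Nat.factorial_succ]
  push_cast
  field_simp

theorem taylorCoeffZero_solution_recurrence {m n p q : ℕ} (hq : (q : ℤ) = (m : ℤ) - (p : ℤ) + 2)
    {γ A B : ℂ} {u : ℂ × ℂ → ℂ} {Ω : Set (ℂ × ℂ)} (hΩ : IsOpen Ω) (hu : AnalyticOnNhd ℂ u Ω)
    (hpde : ∀ t x : ℂ, (t, x) ∈ Ω → t ≠ 0 →
      x ^ m * (pderivFst (pderivFst u) (t, x) + γ / t * pderivFst u (t, x))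
        - t ^ n * x ^ ((p : ℤ) - 2) * (x ^ 2 * pderivSnd (pderivSnd u) (t, x)
            + A * x * pderivSnd u (t, x) + B * u (t, x)) = 0)
    {x : ℂ} (hx : (0, x) ∈ Ω) (hx0 : x ≠ 0) (h0 : pderivFst u (0, x) = 0) (k : ℕ) :
    (k + 1) * (k + γ) * taylorCoeffZero (k + 1) (fun t => u (t, x)) =
      if n + 1 ≤ k then (x ^ q)⁻¹ *
        (x ^ 2 * deriv (deriv fun y => taylorCoeffZero (k - (n + 1)) fun t => u (t, y)) x
        + A * x * deriv (fun y => taylorCoeffZero (k - (n + 1)) fun t => u (t, y)) x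
        + B * taylorCoeffZero (k - (n + 1)) (fun t => u (t, x))) else 0 := by
  have hux := hu _ hx
  have hc : AnalyticAt ℂ (fun t : ℂ => (t, x)) 0 := analyticAt_id.prod analyticAt_const
  have hφ : AnalyticAt ℂ (fun t : ℂ => u (t, x)) 0 := AnalyticAt.comp hux hc
  have hψ : AnalyticAt ℂ (fun t : ℂ => (x ^ q)⁻¹ * (x ^ 2 * pderivSnd (pderivSnd u) (t, x)
      + A * x * pderivSnd u (t, x) + B * u (t, x))) 0 :=
    analyticAt_const.mul (((analyticAt_const.mul
      (AnalyticAt.comp (f := fun t : ℂ => (t, x)) (x := 0) hux.pderivSnd.pderivSnd hc)).add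
      (analyticAt_const.mul
        (AnalyticAt.comp (f := fun t : ℂ => (t, x)) (x := 0) hux.pderivSnd hc))).add
      (analyticAt_const.mul hφ))
  have hev : ∀ᶠ t in 𝓝 (0 : ℂ), (t, x) ∈ Ω := hc.continuousAt.eventually (hΩ.mem_nhds hx)
  rw [taylorCoeffZero_recurrence hφ hψ γ (n + 1), taylorCoeffZero_const_mul,
    taylorCoeffZero_euler hΩ hu A B hx]
  filter_upwards [hev] with t ht
  change t * pderivFst (pderivFst u) (t, x) + γ * pderivFst u (t, x) = _
  rcases eq_or_ne t 0 with rfl | ht0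
  · simp [h0]
  have hz : x ^ ((p : ℤ) - 2) = x ^ m * (x ^ q)⁻¹ := by
    rw [show (p : ℤ) - 2 = (m : ℤ) - (q : ℤ) by omega, zpow_sub₀ hx0, zpow_natCast, zpow_natCast,
      div_eq_mul_inv]
  have hxm : x ^ m ≠ 0 := pow_ne_zero m hx0
  have h := hpde t x ht ht0
  rw [hz] at h
  generalize (x ^ q)⁻¹ = y at h ⊢
  refine mul_left_cancel₀ hxm ?_
  field_simp at h
  linear_combination h

/-- The Taylor coefficients in `t` of `x ^ l * F(a, b, c, s ^ 2 * t ^ w / x ^ q)`, up to powers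
of `x`. -/
noncomputable def hypSparseCoeff (a b c s : ℂ) (w k : ℕ) : ℂ :=
  if w ∣ k then hypCoeff a b c (k / w) * s ^ (2 * (k / w)) else 0

theorem taylorCoeffZero_solution {m n p q : ℕ} (hq : (q : ℤ) = (m : ℤ) - (p : ℤ) + 2) (hq0 : 0 < q)
    {γ A B α : ℂ} (hγ : ∀ k : ℕ, γ ≠ -((k : ℂ) + 1)) (hα : α * (α - A + 1) = -B) {l : ℕ}
    {a b c : ℂ} (ha : a = -(α + (l : ℂ)) / (q : ℂ)) (hb : b = (1 + α - A - (l : ℂ)) / (q : ℂ))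
    (hc : c = ((n : ℂ) + γ + 1) / ((n : ℂ) + 2)) (hc' : ∀ k : ℕ, -c ≠ (k : ℂ))
    {u : ℂ × ℂ → ℂ} {Ω : Set (ℂ × ℂ)} (hΩ : IsOpen Ω) (hu : AnalyticOnNhd ℂ u Ω)
    (hpde : ∀ t x : ℂ, (t, x) ∈ Ω → t ≠ 0 →
      x ^ m * (pderivFst (pderivFst u) (t, x) + γ / t * pderivFst u (t, x))
        - t ^ n * x ^ ((p : ℤ) - 2) * (x ^ 2 * pderivSnd (pderivSnd u) (t, x)
            + A * x * pderivSnd u (t, x) + B * u (t, x)) = 0)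
    (hdata : ∀ x : ℂ, ((0 : ℂ), x) ∈ Ω → u (0, x) = x ^ l ∧ pderivFst u (0, x) = 0) (k : ℕ)
    {x : ℂ} (hx : (0, x) ∈ Ω) (hx0 : x ≠ 0) :
    taylorCoeffZero k (fun t => u (t, x)) =
      hypSparseCoeff a b c ((q : ℂ) / ((n : ℂ) + 2)) (n + 2) k *
        x ^ ((l : ℤ) - q * (k / (n + 2) : ℕ)) := by
  induction k using Nat.strong_induction_on generalizing x with
  | _ k ih =>
  rcases k with _ | k
  · simp [taylorCoeffZero, hypSparseCoeff, hypCoeff, poch, (hdata x hx).1]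
  have hrec := taylorCoeffZero_solution_recurrence hq hΩ hu hpde hx hx0 (hdata x hx).2 k
  have hk1 : (k : ℂ) + 1 ≠ 0 := mod_cast k.succ_ne_zero
  rcases Nat.eq_zero_or_pos k with rfl | hkpos
  · have h1 : taylorCoeffZero 1 (fun t => u (t, x)) = 0 := by
      simpa [taylorCoeffZero, iteratedDeriv_one, pderivFst] using (hdata x hx).2
    simp [h1, hypSparseCoeff]
  have hkγ : (k : ℂ) + γ ≠ 0 := by
    intro h
    apply hγ (k - 1)
    rw [Nat.cast_sub hkpos]
    push_cast
    linear_combination h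
  refine mul_left_cancel₀ (mul_ne_zero hk1 hkγ) ?_
  rw [hrec]
  split_ifs with hk
  · obtain ⟨j, rfl⟩ := Nat.exists_eq_add_of_le hk
    have hsub : n + 1 + j - (n + 1) = j := by omega
    have hsucc : n + 1 + j + 1 = j + (n + 2) := by omega
    have hev : ∀ᶠ y in 𝓝 x, taylorCoeffZero j (fun t => u (t, y)) =
        hypSparseCoeff a b c ((q : ℂ) / ((n : ℂ) + 2)) (n + 2) j *
          y ^ ((l : ℤ) - q * (j / (n + 2) : ℕ)) := by
      have hcont : ContinuousAt (fun y : ℂ => ((0 : ℂ), y)) x := by fun_prop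
      filter_upwards [hcont.eventually (hΩ.mem_nhds hx), eventually_ne_nhds hx0] with y hy hy0
      exact ih j (by omega) hy hy0
    rw [hsub, hsucc, euler_operator_const_mul_zpow hx0 A B _ _ hev,
      Nat.add_div_right _ (by omega : 0 < n + 2), hypSparseCoeff, hypSparseCoeff]
    have hexp : x ^ ((l : ℤ) - q * ((j / (n + 2)).succ : ℕ)) =
        x ^ ((l : ℤ) - q * (j / (n + 2) : ℕ)) * (x ^ q)⁻¹ := by
      rw [← zpow_natCast x q, ← zpow_neg, ← zpow_add₀ hx0]
      congr 1
      push_cast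
      ring
    rw [hexp, Nat.add_div_right _ (by omega : 0 < n + 2)]
    by_cases hdvd : n + 2 ∣ j
    · rw [if_pos hdvd, if_pos (by simpa using hdvd)]
      obtain ⟨i, rfl⟩ := hdvd
      rw [Nat.mul_div_cancel_left i (by omega : 0 < n + 2)]
      have hw : (n : ℂ) + 2 ≠ 0 := mod_cast (by omega : n + 2 ≠ 0)
      have hqc : (q : ℂ) ≠ 0 := mod_cast hq0.ne'
      have hs := hypCoeff_succ hc' a b i
      have ha' : a * q = -(α + l) := by rw [ha]; field_simp
      have hb' : b * q = 1 + α - A - l := by rw [hb]; field_simp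
      have hcw : c * (n + 2) = n + γ + 1 := by rw [hc]; field_simp
      have e1 : ((l : ℂ) - q * i) * (l - q * i - 1) + A * (l - q * i) + B =
          q ^ 2 * ((a + i) * (b + i)) := by
        linear_combination (-(b * q) - q * i) * ha' + (α + l - q * i) * hb' + hα
      have e2 : ((n : ℂ) + 2) * (i + 1) * (n + 1 + (n + 2) * i + γ) =
          (n + 2) ^ 2 * ((i + 1) * (c + i)) := by
        linear_combination -(n + 2) * (i + 1) * hcw
      generalize x ^ ((l : ℤ) - q * (i : ℕ)) = y
      generalize (x ^ q)⁻¹ = z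
      push_cast
      rw [e1, show 2 * (i + 1) = 2 * i + 2 by ring, pow_add, div_pow _ _ 2]
      generalize ((q : ℂ) / (n + 2)) ^ (2 * i) = r
      field_simp
      linear_combination (-(z * r * y * (n + 2) ^ 2)) * hs -
        z * r * y * hypCoeff a b c (i + 1) * e2
    · rw [if_neg hdvd, if_neg (by simpa using hdvd)]
      simp
  · rw [hypSparseCoeff, if_neg]
    · simp
    · intro h
      have := Nat.le_of_dvd (by omega) h
      omega

theorem tsum_hypSparseCoeff (a b c s : ℂ) {w : ℕ} (hw : 0 < w) (q l : ℕ) (t : ℂ) {x : ℂ}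
    (hx : x ≠ 0) :
    ∑' k : ℕ, t ^ k * (hypSparseCoeff a b c s w k * x ^ ((l : ℤ) - q * (k / w : ℕ))) =
      x ^ l * hypF a b c (s ^ 2 * t ^ w / x ^ q) := by
  have hinj : Function.Injective fun i : ℕ => w * i := fun i j h => Nat.eq_of_mul_eq_mul_left hw h
  rw [← hinj.tsum_eq, hypF, ← tsum_mul_left]
  · congr 1
    funext i
    rw [hypSparseCoeff, if_pos (Nat.dvd_mul_right w i), Nat.mul_div_cancel_left i hw,
      zpow_sub₀ hx, zpow_natCast, zpow_mul, zpow_natCast, zpow_natCast, pow_mul, pow_mul, div_pow,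
      mul_pow, hypCoeff]
    ring
  · intro k hk
    by_contra hr
    apply hk
    have hdvd : ¬ w ∣ k := fun ⟨i, hi⟩ => hr ⟨i, hi.symm⟩
    simp [hypSparseCoeff, hdvd]

/-- (Uniqueness.) If `γ` is not a negative integer and `u` is an analytic
solution on a neighborhood of `(0, x₀)` (with `x₀ ≠ 0`) of the characteristic Cauchy problem
`L_γ u = 0`, `u(0,x) = x^l`, `∂_t u(0,x) = 0`, then `u` coincides with
`U_l(t,x) = x^l · F(a,b,c,(q/(n+2))² t^(n+2)/x^q)` near `(0, x₀)`. -/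
theorem uniqueness_of_solution (m n p : ℕ) (q : ℕ)
    (hq : (q : ℤ) = (m : ℤ) - (p : ℤ) + 2) (hq0 : 0 < q)
    (γ A B α : ℂ) (hγ : ∀ k : ℕ, γ ≠ -((k : ℂ) + 1)) (hα : α * (α - A + 1) = -B) (l : ℕ)
    (a b c : ℂ)
    (ha : a = -(α + (l : ℂ)) / (q : ℂ))
    (hb : b = (1 + α - A - (l : ℂ)) / (q : ℂ))
    (hc : c = ((n : ℂ) + γ + 1) / ((n : ℂ) + 2))
    (hc' : ∀ k : ℕ, -c ≠ (k : ℂ))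
    (x₀ : ℂ) (hx₀ : x₀ ≠ 0)
    (u : ℂ × ℂ → ℂ) (Ω : Set (ℂ × ℂ)) (hΩ : IsOpen Ω) (hmem : ((0 : ℂ), x₀) ∈ Ω)
    (hu : AnalyticOnNhd ℂ u Ω)
    (hpde : ∀ t x : ℂ, (t, x) ∈ Ω → t ≠ 0 →
      x ^ m * (deriv (fun s => deriv (fun s' => u (s', x)) s) t
          + γ / t * deriv (fun s => u (s, x)) t)
        - t ^ n * x ^ ((p : ℤ) - 2) *
          (x ^ 2 * deriv (fun y => deriv (fun y' => u (t, y')) y) x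
            + A * x * deriv (fun y => u (t, y)) x + B * u (t, x)) = 0)
    (hdata : ∀ x : ℂ, ((0 : ℂ), x) ∈ Ω →
      u (0, x) = x ^ l ∧ deriv (fun s => u (s, x)) 0 = 0) :
    ∀ᶠ P in nhds (((0 : ℂ), x₀) : ℂ × ℂ),
      u P = P.2 ^ l * hypF a b c (((q : ℂ) / ((n : ℂ) + 2)) ^ 2 * P.1 ^ (n + 2) / P.2 ^ q) := by

  obtain ⟨r, hr, hball⟩ := Metric.isOpen_iff.1
    (hΩ.inter (isOpen_ne_fun continuous_snd (continuous_const (y := (0 : ℂ)))))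
    ((0 : ℂ), x₀) ⟨hmem, hx₀⟩
  filter_upwards [Metric.ball_mem_nhds ((0 : ℂ), x₀) hr] with P hP
  obtain ⟨t, x⟩ := P
  rw [← ball_prod_same] at hball hP
  have hxmem : ∀ s ∈ Metric.ball (0 : ℂ) r, (s, x) ∈ Ω := fun s hs =>
    (hball (Set.mk_mem_prod hs hP.2)).1
  have hx : ((0 : ℂ), x) ∈ Ω := hxmem 0 (Metric.mem_ball_self hr)
  have hx0 : x ≠ 0 := (hball hP).2
  have hdiff : DifferentiableOn ℂ (fun s => u (s, x)) (Metric.ball 0 r) := fun s hs =>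
    ((hu _ (hxmem s hs)).differentiableAt.comp s (f := fun s : ℂ => (s, x))
      (by fun_prop)).differentiableWithinAt
  have hsum := (Complex.hasSum_taylorSeries_on_ball hdiff hP.1).tsum_eq
  change u (t, x) = x ^ l * hypF a b c (((q : ℂ) / ((n : ℂ) + 2)) ^ 2 * t ^ (n + 2) / x ^ q)
  rw [← tsum_hypSparseCoeff a b c _ (by omega : 0 < n + 2) q l t hx0, ← hsum]
  congr 1
  funext k
  rw [← taylorCoeffZero_solution hq hq0 hγ hα ha hb hc hc' hΩ hu hpde hdata k hx hx0,
    taylorCoeffZero, smul_eq_mul, smul_eq_mul, sub_zero]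
  ring
end

section
/- Let a, b, c be real numbers with a ≥ b > c > 0. Then for every i ∈ ℕ, (a)_i (b)_i / ((c)_i · i!) ≤ (Γ(c)·Γ(a+b−c) / (Γ(a)·Γ(b))) · (a+b−c)_i / i!. In other words, the hypergeometric series F(a,b,c;z) is majorized coefficientwise by (Γ(c)Γ(a+b−c)/(Γ(a)Γ(b))) · (1−z)^{c−a−b}. -/
/-- By log-convexity, the product of two values of `Γ` with a prescribed sum of arguments grows
as the arguments spread apart. -/
theorem Real.Gamma_mul_Gamma_le_of_lt {a b c : ℝ} (hc : 0 < c) (hca : c < a) (hcb : c < b) :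
    Real.Gamma a * Real.Gamma b ≤ Real.Gamma c * Real.Gamma (a + b - c) := by
  have hd : 0 < a + b - c := by linarith
  have hw : 0 < a + b - 2 * c := by linarith
  obtain ⟨θ, hθ_pos, hθ_lt, hθ⟩ : ∃ θ : ℝ, 0 < θ ∧ θ < 1 ∧ θ * (a + b - 2 * c) = a - c :=
    ⟨(a - c) / (a + b - 2 * c), div_pos (by linarith) hw, (div_lt_one hw).2 (by linarith),
      div_mul_cancel₀ _ hw.ne'⟩
  obtain ⟨η, hsum⟩ : ∃ η, θ + η = 1 := ⟨1 - θ, by ring⟩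
  have hη_pos : 0 < η := by linarith
  have ha : η * c + θ * (a + b - c) = a := by linear_combination hθ + c * hsum
  have hb : θ * c + η * (a + b - c) = b := by
    linear_combination (a + b - c) * hsum - hθ
  have hGa := Real.Gamma_mul_add_mul_le_rpow_Gamma_mul_rpow_Gamma hc hd hη_pos hθ_pos
    (by linarith)
  have hGb := Real.Gamma_mul_add_mul_le_rpow_Gamma_mul_rpow_Gamma hc hd hθ_pos hη_pos hsum
  rw [ha] at hGa
  rw [hb] at hGb
  have hGc_pos := Real.Gamma_pos_of_pos hc
  have hGd_pos := Real.Gamma_pos_of_pos hd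
  have hGb_pos := Real.Gamma_pos_of_pos (hc.trans hcb)
  calc Real.Gamma a * Real.Gamma b
      ≤ (Real.Gamma c ^ η * Real.Gamma (a + b - c) ^ θ) *
          (Real.Gamma c ^ θ * Real.Gamma (a + b - c) ^ η) := by gcongr
    _ = Real.Gamma c ^ (θ + η) * Real.Gamma (a + b - c) ^ (θ + η) := by
        rw [Real.rpow_add hGc_pos, Real.rpow_add hGd_pos]; ring
    _ = Real.Gamma c * Real.Gamma (a + b - c) := by simp [hsum]

theorem Real.Gamma_add_natCast_eq_ascPochhammer_mul {x : ℝ} (hx : 0 < x) (i : ℕ) :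
    Real.Gamma (x + i) = (ascPochhammer ℝ i).eval x * Real.Gamma x := by
  induction i with
  | zero => simp
  | succ n ih =>
    rw [Nat.cast_succ, ← add_assoc, Real.Gamma_add_one (by positivity), ih,
      ascPochhammer_succ_eval]
    ring

/-- (Coefficientwise majorization of the hypergeometric series.)
For real `a ≥ b > c > 0` and every `i ∈ ℕ`,
`(a)ᵢ(b)ᵢ/((c)ᵢ·i!) ≤ (Γ(c)Γ(a+b−c)/(Γ(a)Γ(b))) · (a+b−c)ᵢ/i!`, i.e.
`F(a,b,c;z) ≪ (Γ(c)Γ(a+b−c)/(Γ(a)Γ(b))) (1−z)^(c−a−b)`. -/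
theorem hypergeometric_majorant (a b c : ℝ) (hab : b ≤ a) (hbc : c < b) (hc : 0 < c)
    (i : ℕ) :
    (ascPochhammer ℝ i).eval a * (ascPochhammer ℝ i).eval b /
        ((ascPochhammer ℝ i).eval c * (Nat.factorial i : ℝ))
      ≤ Real.Gamma c * Real.Gamma (a + b - c) / (Real.Gamma a * Real.Gamma b) *
          ((ascPochhammer ℝ i).eval (a + b - c) / (Nat.factorial i : ℝ)) := by
  have hb : 0 < b := hc.trans hbc
  have ha : 0 < a := hb.trans_le hab
  have hd : 0 < a + b - c := by linarith
  have key := Real.Gamma_mul_Gamma_le_of_lt (a := a + i) (b := b + i) (c := c + i)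
    (by positivity) (by linarith) (by linarith)
  rw [show a + i + (b + i) - (c + i) = a + b - c + i by ring,
    Real.Gamma_add_natCast_eq_ascPochhammer_mul ha, Real.Gamma_add_natCast_eq_ascPochhammer_mul hb,
    Real.Gamma_add_natCast_eq_ascPochhammer_mul hc,
    Real.Gamma_add_natCast_eq_ascPochhammer_mul hd] at key
  have hGa := Real.Gamma_pos_of_pos ha
  have hGb := Real.Gamma_pos_of_pos hb
  have hPc := ascPochhammer_pos i c hc
  rw [div_mul_div_comm, div_le_div_iff₀ (by positivity) (by positivity)]
  linear_combination (Nat.factorial i : ℝ) * key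
end

section
/- Let q ≥ 1 be a natural number and let η₁, η₂, η₃ be positive real numbers with η₁ + η₂ > η₃. Define C_l = Γ(η₃)·Γ(2l/q + η₁ + η₂ − η₃) / (Γ(l/q + η₁)·Γ(l/q + η₂)) for l ∈ ℕ. Then limsup_{l→∞} C_l^{1/l} ≤ 2^{2/q}. -/
open Filter Topology

/-- Midpoint log-convexity of the Gamma function on the positive reals. -/
lemma Real.Gamma_midpoint_sq_le {a b : ℝ} (ha : 0 < a) (hb : 0 < b) :
    Real.Gamma ((a + b) / 2) ^ 2 ≤ Real.Gamma a * Real.Gamma b := by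
  have h := Real.Gamma_mul_add_mul_le_rpow_Gamma_mul_rpow_Gamma ha hb
    (a := 1 / 2) (b := 1 / 2) (by norm_num) (by norm_num) (by norm_num)
  rw [← Real.mul_rpow (Real.Gamma_pos_of_pos ha).le (Real.Gamma_pos_of_pos hb).le,
    ← Real.sqrt_eq_rpow, show 1 / 2 * a + 1 / 2 * b = (a + b) / 2 by ring] at h
  exact (Real.le_sqrt' (Real.Gamma_pos_of_pos (by positivity))).1 h

/-- A crude duplication estimate: `Γ(2s) ≤ s 2^(2s) Γ(s)^2` for large `s`. -/
lemma Real.Gamma_two_mul_le {s : ℝ} (hs : 3 / 2 ≤ s) :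
    Real.Gamma (2 * s) ≤ s * 2 ^ (2 * s) * Real.Gamma s ^ 2 := by
  have hs0 : 0 < s := by linarith
  have hG : 0 < Real.Gamma s := Real.Gamma_pos_of_pos hs0
  have hG2 : 0 < Real.Gamma (2 * s) := Real.Gamma_pos_of_pos (by positivity)
  have hdup := Real.Gamma_mul_Gamma_add_half s
  have hmono : Real.Gamma (s + 1 / 2) ≤ s * Real.Gamma s := by
    rw [← Real.Gamma_add_one hs0.ne']
    exact Real.Gamma_strictMonoOn_Ici.monotoneOn (by simp; linarith) (by simp; linarith)
      (by linarith)
  have hpi : 1 ≤ √Real.pi := Real.one_le_sqrt.2 (by linarith [Real.pi_gt_three])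
  have h2 : 2 ^ (2 * s) * (2 : ℝ) ^ (1 - 2 * s) = 2 := by
    rw [← Real.rpow_add two_pos]; simp
  calc Real.Gamma (2 * s) ≤ Real.Gamma (2 * s) * (2 * √Real.pi) :=
        le_mul_of_one_le_right hG2.le (by linarith)
    _ = 2 ^ (2 * s) * (Real.Gamma (2 * s) * 2 ^ (1 - 2 * s) * √Real.pi) := by
        linear_combination (-Real.Gamma (2 * s) * √Real.pi) * h2
    _ = 2 ^ (2 * s) * (Real.Gamma s * Real.Gamma (s + 1 / 2)) := by rw [hdup]
    _ ≤ 2 ^ (2 * s) * (Real.Gamma s * (s * Real.Gamma s)) := by gcongr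
    _ = s * 2 ^ (2 * s) * Real.Gamma s ^ 2 := by ring

/-- The Gamma quotient grows at most like `x 4^x`. -/
lemma Real.Gamma_quotient_le {a b c x : ℝ} (ha : 0 < a) (hb : 0 < b) (hc : 0 < c)
    (habc : c < a + b) (hx : 2 ≤ x) :
    Real.Gamma (2 * x + a + b - c) / (Real.Gamma (x + a) * Real.Gamma (x + b)) ≤
      (x + (a + b) / 2) * 2 ^ (2 * x + (a + b)) := by
  have hGa : 0 < Real.Gamma (x + a) := Real.Gamma_pos_of_pos (by linarith)
  have hGb : 0 < Real.Gamma (x + b) := Real.Gamma_pos_of_pos (by linarith)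
  rw [div_le_iff₀ (by positivity)]
  have hmid := Real.Gamma_midpoint_sq_le (show 0 < x + a by linarith) (show 0 < x + b by linarith)
  have hdup := Real.Gamma_two_mul_le (s := x + (a + b) / 2) (by linarith)
  rw [show (x + a + (x + b)) / 2 = x + (a + b) / 2 by ring] at hmid
  rw [show 2 * (x + (a + b) / 2) = 2 * x + (a + b) by ring] at hdup
  calc Real.Gamma (2 * x + a + b - c) ≤ Real.Gamma (2 * x + (a + b)) :=
        Real.Gamma_strictMonoOn_Ici.monotoneOn (by simp; linarith) (by simp; linarith)
          (by linarith)
    _ ≤ _ := hdup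
    _ ≤ _ := by gcongr

/-- If `0 ≤ u l ≤ A l B^l` eventually, then `limsup (u l)^(1/l) ≤ B`. -/
lemma limsup_rpow_one_div_le {u : ℕ → ℝ} {A B : ℝ} (hA : 0 < A) (hB : 0 < B)
    (hu0 : ∀ᶠ l in atTop, 0 ≤ u l) (hu : ∀ᶠ l : ℕ in atTop, u l ≤ A * l * B ^ l) :
    limsup (fun l : ℕ => u l ^ (1 / (l : ℝ))) atTop ≤ B := by
  have hlim : Tendsto (fun l : ℕ => A ^ (1 / (l : ℝ)) * (l : ℝ) ^ (1 / (l : ℝ)) * B)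
      atTop (𝓝 B) := by
    have h1 : Tendsto (fun l : ℕ => A ^ (1 / (l : ℝ))) atTop (𝓝 1) := by
      simpa using (tendsto_const_nhds (x := A)).rpow
        (tendsto_one_div_atTop_nhds_zero_nat (𝕜 := ℝ)) (Or.inl hA.ne')
    have h2 : Tendsto (fun l : ℕ => (l : ℝ) ^ (1 / (l : ℝ))) atTop (𝓝 1) :=
      tendsto_rpow_div.comp tendsto_natCast_atTop_atTop
    simpa using (h1.mul h2).mul_const B
  rw [← hlim.limsup_eq]
  refine limsup_le_limsup ?_ ?_ hlim.isBoundedUnder_le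
  · filter_upwards [hu0, hu, eventually_ne_atTop 0] with l h0 hl hl0
    have hB' : (B ^ l) ^ (1 / (l : ℝ)) = B := by
      rw [one_div, Real.pow_rpow_inv_natCast hB.le hl0]
    calc u l ^ (1 / (l : ℝ)) ≤ (A * l * B ^ l) ^ (1 / (l : ℝ)) := by gcongr
      _ = _ := by
        rw [Real.mul_rpow (by positivity) (by positivity),
          Real.mul_rpow hA.le (by positivity), hB']
  · refine IsBoundedUnder.isCoboundedUnder_le ⟨0, ?_⟩
    rw [eventually_map]
    filter_upwards [hu0] with l h0
    exact Real.rpow_nonneg h0 _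

/-- For `q ≥ 1` and positive reals `η₁, η₂, η₃` with `η₁ + η₂ > η₃`, the
Gamma-quotient constants `C_l = Γ(η₃)Γ(2l/q + η₁ + η₂ − η₃)/(Γ(l/q + η₁)Γ(l/q + η₂))` satisfy
`limsup_{l→∞} C_l^(1/l) ≤ 2^(2/q)`. -/
theorem limsup_gamma_quotient (q : ℕ) (hq : 1 ≤ q)
    (η₁ η₂ η₃ : ℝ) (h₁ : 0 < η₁) (h₂ : 0 < η₂) (h₃ : 0 < η₃) (hsum : η₃ < η₁ + η₂)
    (C : ℕ → ℝ)
    (hC : ∀ l : ℕ, C l =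
      Real.Gamma η₃ * Real.Gamma (2 * (l : ℝ) / (q : ℝ) + η₁ + η₂ - η₃) /
        (Real.Gamma ((l : ℝ) / (q : ℝ) + η₁) * Real.Gamma ((l : ℝ) / (q : ℝ) + η₂))) :
    limsup (fun l : ℕ => C l ^ (1 / (l : ℝ))) atTop ≤ (2 : ℝ) ^ (2 / (q : ℝ)) := by
  have hq0 : (0 : ℝ) < q := by exact_mod_cast hq
  have hq1 : (1 : ℝ) ≤ q := by exact_mod_cast hq
  have hG : 0 < Real.Gamma η₃ := Real.Gamma_pos_of_pos h₃
  refine limsup_rpow_one_div_le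
    (A := Real.Gamma η₃ * ((1 + (η₁ + η₂) / 2) * 2 ^ (η₁ + η₂))) (by positivity) (by positivity)
    ?_ ?_
  · refine Eventually.of_forall fun l => ?_
    have hx : (0 : ℝ) ≤ 2 * l / q := by positivity
    rw [hC l]
    have := Real.Gamma_pos_of_pos (show 0 < 2 * (l : ℝ) / q + η₁ + η₂ - η₃ by linarith)
    have := Real.Gamma_pos_of_pos (show 0 < (l : ℝ) / q + η₁ by positivity)
    have := Real.Gamma_pos_of_pos (show 0 < (l : ℝ) / q + η₂ by positivity)
    positivity
  · filter_upwards [eventually_ge_atTop (2 * q), eventually_ge_atTop 1] with l hl hl1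
    have hx : 2 ≤ (l : ℝ) / q := by
      rw [le_div_iff₀ hq0]
      exact_mod_cast hl
    have hl1' : (1 : ℝ) ≤ l := by exact_mod_cast hl1
    have hlq : (l : ℝ) / q ≤ l := div_le_self (by positivity) hq1
    have key := Real.Gamma_quotient_le h₁ h₂ h₃ hsum hx
    have hpow : (2 : ℝ) ^ (2 * ((l : ℝ) / q) + (η₁ + η₂)) =
        2 ^ (η₁ + η₂) * ((2 : ℝ) ^ (2 / (q : ℝ))) ^ l := by
      rw [← Real.rpow_mul_natCast two_pos.le, ← Real.rpow_add two_pos]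
      ring_nf
    have hlin : (l : ℝ) / q + (η₁ + η₂) / 2 ≤ (1 + (η₁ + η₂) / 2) * l := by
      nlinarith
    rw [hC l, mul_div_assoc, mul_div_assoc]
    calc _ ≤ _ := mul_le_mul_of_nonneg_left key hG.le
      _ ≤ Real.Gamma η₃ * ((1 + (η₁ + η₂) / 2) * l *
          (2 ^ (η₁ + η₂) * ((2 : ℝ) ^ (2 / (q : ℝ))) ^ l)) := by
        rw [hpow]; gcongr
      _ = _ := by ring
end

section
/- For every λ ∈ ℂ, the function u_λ(t,x) = (x³−t³)^{1/3} + λt², with the principal branch of the complex power, satisfies x⁴(∂_t² u − (1/t) ∂_t u) − t·x·(x² ∂_x² u − x ∂_x u) = 0 at every (t,x) ∈ ℂ² with t ≠ 0 and x³ − t³ ∉ ℝ_{≤0}; moreover, for every x with |arg x| < π/3, u_λ(0,x) = x and ∂_t u_λ(0,x) = 0. Consequently, the characteristic Cauchy problem with γ = −1 (a negative integer) admits infinitely many distinct solutions with the same Cauchy data u(0,x) = x, ∂_t u(0,x) = 0: for λ ≠ μ the functions u_λ and u_μ differ. -/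
/-- `s ↦ (x³ - s³)^c` has the expected derivative off the branch cut. -/
theorem hasDerivAt_cpow_cube_sub_left (c x t : ℂ) (h : x ^ 3 - t ^ 3 ∈ Complex.slitPlane) :
    HasDerivAt (fun s : ℂ => (x ^ 3 - s ^ 3) ^ c)
      (c * (x ^ 3 - t ^ 3) ^ (c - 1) * (-(3 * t ^ 2))) t := by
  have h1 : HasDerivAt (fun s : ℂ => x ^ 3 - s ^ 3) (-(3 * t ^ 2)) t := by
    simpa using (hasDerivAt_pow 3 t).const_sub (x ^ 3)
  exact h1.cpow_const h

/-- `y ↦ (y³ - t³)^c` has the expected derivative off the branch cut. -/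
theorem hasDerivAt_cpow_cube_sub_right (c t x : ℂ) (h : x ^ 3 - t ^ 3 ∈ Complex.slitPlane) :
    HasDerivAt (fun y : ℂ => (y ^ 3 - t ^ 3) ^ c)
      (c * (x ^ 3 - t ^ 3) ^ (c - 1) * (3 * x ^ 2)) x := by
  have h1 : HasDerivAt (fun y : ℂ => y ^ 3 - t ^ 3) (3 * x ^ 2) x := by
    simpa using (hasDerivAt_pow 3 x).sub_const (t ^ 3)
  exact h1.cpow_const h

/-- A function of `t³` has derivative `0` at the origin (in the sense of `deriv`), because it is
invariant under multiplication of `t` by a primitive cube root of unity. -/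
theorem deriv_comp_cube_zero (f : ℂ → ℂ) : deriv (fun t : ℂ => f (t ^ 3)) 0 = 0 := by
  obtain ⟨ω, hω⟩ : ∃ ω : ℂ, IsPrimitiveRoot ω 3 :=
    ⟨_, Complex.isPrimitiveRoot_exp 3 (by norm_num)⟩
  have h := deriv_comp_mul_left ω (fun t : ℂ => f (t ^ 3)) 0
  simp only [mul_pow, hω.pow_eq_one, one_mul, mul_zero, smul_eq_mul] at h
  have h1 : (1 - ω) * deriv (fun t : ℂ => f (t ^ 3)) 0 = 0 := by linear_combination h
  refine (mul_eq_zero.mp h1).resolve_left fun h2 => hω.ne_one (by norm_num) ?_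
  linear_combination -h2

/-- Adding a function with vanishing derivative does not change the value of `deriv`. -/
theorem deriv_add_of_hasDerivAt_zero {f g : ℂ → ℂ} {z : ℂ} (hg : HasDerivAt g 0 z) :
    deriv (fun t => f t + g t) z = deriv f z := by
  by_cases hf : DifferentiableAt ℂ f z
  · exact (hf.hasDerivAt.add hg).deriv.trans (add_zero _)
  · rw [deriv_zero_of_not_differentiableAt hf, deriv_zero_of_not_differentiableAt]
    intro h
    exact hf ((h.sub hg.differentiableAt).congr_of_eventuallyEq
      (Filter.Eventually.of_forall fun t => by simp))

/-- (Non-uniqueness for `γ = −1`.) For every `λ ∈ ℂ`, the function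
`u_λ(t,x) = (x³−t³)^(1/3) + λt²` (principal branch) solves
`x⁴(∂_t²u − (1/t)∂_t u) − t x (x² ∂_x²u − x ∂_x u) = 0` for `t ≠ 0` with
`x³ − t³` in the slit plane, and for `|arg x| < π/3` it satisfies `u_λ(0,x) = x`,
`∂_t u_λ(0,x) = 0`; moreover distinct `λ` give distinct solutions, so uniqueness fails. -/
theorem example_nonuniqueness (u : ℂ → ℂ → ℂ → ℂ)
    (hu : ∀ lam t x : ℂ, u lam t x = (x ^ 3 - t ^ 3) ^ ((1 / 3 : ℂ)) + lam * t ^ 2) :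
    (∀ lam : ℂ, ∀ t x : ℂ, t ≠ 0 → (x ^ 3 - t ^ 3) ∈ Complex.slitPlane →
      x ^ 4 * (dT (dT (u lam)) t x - 1 / t * dT (u lam) t x)
        - t * x * (x ^ 2 * dX (dX (u lam)) t x - x * dX (u lam) t x) = 0)
    ∧ (∀ lam : ℂ, ∀ x : ℂ, |Complex.arg x| < Real.pi / 3 →
        u lam 0 x = x ∧ deriv (fun t => u lam t x) 0 = 0)
    ∧ (∀ lam mu : ℂ, lam ≠ mu → u lam ≠ u mu) := by
  refine ⟨fun lam t x ht hw => ?_, fun lam x hx => ⟨?_, ?_⟩, fun lam mu hne h => hne ?_⟩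
  · have hT : ∀ s : ℂ, x ^ 3 - s ^ 3 ∈ Complex.slitPlane → dT (u lam) s x =
        -(s ^ 2 * (x ^ 3 - s ^ 3) ^ (1 / 3 - 1 : ℂ)) + lam * (2 * s) := fun s hs => by
      have h1 := (hasDerivAt_cpow_cube_sub_left (1 / 3) x s hs).add
        ((hasDerivAt_pow 2 s).const_mul lam)
      simp only [dT, hu]
      refine h1.deriv.trans ?_
      push_cast
      ring
    have hX : ∀ y : ℂ, y ^ 3 - t ^ 3 ∈ Complex.slitPlane → dX (u lam) t y =
        y ^ 2 * (y ^ 3 - t ^ 3) ^ (1 / 3 - 1 : ℂ) := fun y hy => by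
      have h1 := (hasDerivAt_cpow_cube_sub_right (1 / 3) t y hy).add_const (lam * t ^ 2)
      simp only [dX, hu]
      refine h1.deriv.trans ?_
      ring
    have hTT : dT (dT (u lam)) t x =
        -(2 * t * (x ^ 3 - t ^ 3) ^ (1 / 3 - 1 : ℂ)
          + 2 * t ^ 4 * (x ^ 3 - t ^ 3) ^ (1 / 3 - 1 - 1 : ℂ)) + lam * 2 := by
      have hev : ∀ᶠ s in nhds t, x ^ 3 - s ^ 3 ∈ Complex.slitPlane :=
        ContinuousAt.eventually_mem (f := fun s : ℂ => x ^ 3 - s ^ 3) (by fun_prop)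
          (Complex.isOpen_slitPlane.mem_nhds hw)
      have h1 := ((hasDerivAt_pow 2 t).mul
        (hasDerivAt_cpow_cube_sub_left (1 / 3 - 1) x t hw)).neg.add
        (((hasDerivAt_id t).const_mul 2).const_mul lam)
      refine (Filter.EventuallyEq.deriv_eq (hev.mono hT)).trans (h1.deriv.trans ?_)
      push_cast
      ring
    have hXX : dX (dX (u lam)) t x =
        2 * x * (x ^ 3 - t ^ 3) ^ (1 / 3 - 1 : ℂ)
          - 2 * x ^ 4 * (x ^ 3 - t ^ 3) ^ (1 / 3 - 1 - 1 : ℂ) := by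
      have hev : ∀ᶠ y in nhds x, y ^ 3 - t ^ 3 ∈ Complex.slitPlane :=
        ContinuousAt.eventually_mem (f := fun y : ℂ => y ^ 3 - t ^ 3) (by fun_prop)
          (Complex.isOpen_slitPlane.mem_nhds hw)
      have h1 := (hasDerivAt_pow 2 x).mul
        (hasDerivAt_cpow_cube_sub_right (1 / 3 - 1) t x hw)
      refine (Filter.EventuallyEq.deriv_eq (hev.mono hX)).trans (h1.deriv.trans ?_)
      push_cast
      ring
    have hw0 : x ^ 3 - t ^ 3 ≠ 0 := Complex.slitPlane_ne_zero hw
    have hpow : (x ^ 3 - t ^ 3) ^ (1 / 3 - 1 : ℂ) =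
        (x ^ 3 - t ^ 3) ^ (1 / 3 - 1 - 1 : ℂ) * (x ^ 3 - t ^ 3) := by
      rw [Complex.cpow_sub (1 / 3 - 1) 1 hw0, Complex.cpow_one, div_mul_cancel₀ _ hw0]
    rw [hTT, hXX, hT t hw, hX x hw, hpow]
    field_simp
    ring
  · rw [abs_lt] at hx
    have h := Complex.pow_cpow_nat_inv (x := x) (n := 3) (by norm_num)
      (by simpa using hx.1) (by simpa using hx.2.le)
    simpa [hu] using h
  · have hg : HasDerivAt (fun t : ℂ => lam * t ^ 2) 0 0 := by
      simpa using (hasDerivAt_pow 2 (0 : ℂ)).const_mul lam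
    simp only [hu]
    rw [deriv_add_of_hasDerivAt_zero hg]
    exact deriv_comp_cube_zero fun z => (x ^ 3 - z) ^ (1 / 3 : ℂ)
  · simpa [hu] using congrFun (congrFun h 1) 0
end
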